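/- Let w be an infinite binary word that is Sturmian or periodic. Then the slope π(w) exists and there is a constant C such that for every nonempty finite factor u of w, |π(u) − π(w)| ≤ C/|u|. -/

import Mathlib

/-- An infinite binary word: every letter is `0` or `1`. -/
def IsBinaryWord (w : ℕ → ℕ) : Prop := ∀ i, w i ≤ 1

/-- The complexity function of `w`: the number of distinct factors (subwords) of
length `n`, a factor of length `n` being `w (i) w (i+1) ⋯ w (i+n-1)` for some `i`. -/
noncomputable def Complexity (w : ℕ → ℕ) (n : ℕ) : ℕ :=
  Set.ncard { f : Fin n → ℕ | ∃ i : ℕ, f = fun j : Fin n => w (i + j) }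

/-- `w` is Sturmian: `Comp_w(n) = n + 1` for all `n ≥ 1`. -/
noncomputable def IsSturmian (w : ℕ → ℕ) : Prop := ∀ n : ℕ, 1 ≤ n → Complexity w n = n + 1

/-- `w` is periodic with period `T ≥ 1`. -/
def IsPeriodicWord (w : ℕ → ℕ) (T : ℕ) : Prop := 1 ≤ T ∧ ∀ i, w (i + T) = w i

/-- The slope of `w` is `α`: the averages of the first `n` letters tend to `α`. -/
def HasSlope (w : ℕ → ℕ) (α : ℝ) : Prop :=
  Filter.Tendsto (fun n : ℕ => (∑ j ∈ Finset.range n, (w j : ℝ)) / n)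
    Filter.atTop (nhds α)

/-- The height of the factor of `w` of length `n` at position `i`. -/
def factorHeight (w : ℕ → ℕ) (i n : ℕ) : ℕ := ∑ j ∈ Finset.range n, w (i + j)

/-- The factor of `w` of length `n` at position `i`. -/
def factorAt (w : ℕ → ℕ) (n i : ℕ) : Fin n → ℕ := fun j => w (i + j)

section Height

variable {w : ℕ → ℕ}

lemma factorHeight_succ (i n : ℕ) :
    factorHeight w i (n + 1) = factorHeight w i n + w (i + n) :=
  Finset.sum_range_succ _ _

lemma factorHeight_add (i m n : ℕ) :
    factorHeight w i (m + n) = factorHeight w i m + factorHeight w (i + m) n := by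
  simp only [factorHeight, Finset.sum_range_add, add_assoc]

lemma factorHeight_le (hw : IsBinaryWord w) (i n : ℕ) : factorHeight w i n ≤ n := by
  simpa [factorHeight] using Finset.sum_le_sum (s := Finset.range n) fun j _ => hw (i + j)

end Height

section Slope

variable {w : ℕ → ℕ}

/-- A word in which heights of factors of equal length differ by at most `C` has a slope, and
the slopes of its factors converge to it at rate `1 / n`. -/
lemma exists_slope_of_balanced {C : ℕ}
    (hC : ∀ i j n, factorHeight w j n ≤ factorHeight w i n + C) :
    ∃ α : ℝ, HasSlope w α ∧
      ∃ C : ℝ, ∀ i n : ℕ, 1 ≤ n →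
        |(∑ j ∈ Finset.range n, (w (i + j) : ℝ)) / n - α| ≤ C / n := by
  have hC' (i j n : ℕ) : (factorHeight w j n : ℝ) ≤ factorHeight w i n + C := by
    exact_mod_cast hC i j n
  have hsplit (m n : ℕ) :
      (factorHeight w 0 (m + n) : ℝ) = factorHeight w 0 m + factorHeight w m n := by
    exact_mod_cast (by simpa using factorHeight_add (w := w) 0 m n)
  have hcast (i n : ℕ) : (∑ j ∈ Finset.range n, (w (i + j) : ℝ)) = factorHeight w i n := by
    simp [factorHeight]
  have hup : Subadditive fun n => (factorHeight w 0 n : ℝ) + C := fun m n => by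
    linarith [hsplit m n, hC' 0 m n]
  have hlow : Subadditive fun n => (C : ℝ) - factorHeight w 0 n := fun m n => by
    linarith [hsplit m n, hC' m 0 n]
  have hCn : Filter.Tendsto (fun n : ℕ => (C : ℝ) / n) Filter.atTop (nhds 0) :=
    tendsto_const_div_atTop_nhds_zero_nat _
  have hbup : BddBelow (Set.range fun n : ℕ => ((factorHeight w 0 n : ℝ) + C) / n) :=
    ⟨0, by rintro _ ⟨n, rfl⟩; positivity⟩
  have hα : Filter.Tendsto (fun n : ℕ => (factorHeight w 0 n : ℝ) / n) Filter.atTop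
      (nhds hup.lim) := by
    simpa [add_div] using (hup.tendsto_lim hbup).sub hCn
  have hneg : Filter.Tendsto (fun n : ℕ => ((C : ℝ) - factorHeight w 0 n) / n) Filter.atTop
      (nhds (-hup.lim)) := by
    simpa [sub_div] using hCn.sub hα
  have hblow : BddBelow (Set.range fun n : ℕ => ((C : ℝ) - factorHeight w 0 n) / n) :=
    hneg.bddBelow_range
  have hlim : hlow.lim = -hup.lim := tendsto_nhds_unique (hlow.tendsto_lim hblow) hneg
  refine ⟨hup.lim, ?_, 2 * C, fun i n hn => ?_⟩
  · simpa [HasSlope, factorHeight] using hα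
  · have hn0 : (0 : ℝ) < n := by exact_mod_cast hn
    have h₁ := hup.lim_le_div hbup (n := n) (by omega)
    have h₂ := hlow.lim_le_div hblow (n := n) (by omega)
    rw [hlim] at h₂
    rw [le_div_iff₀ hn0] at h₁ h₂
    rw [hcast, abs_le, ← neg_div, div_le_iff₀ hn0, le_div_iff₀ hn0, sub_mul,
      div_mul_cancel₀ _ hn0.ne']
    constructor <;> linarith [hC' 0 i n, hC' i 0 n]

lemma IsPeriodicWord.balanced (hw : IsBinaryWord w) {T : ℕ} (hT : IsPeriodicWord w T)
    (i j n : ℕ) : factorHeight w j n ≤ factorHeight w i n + 2 * T := by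
  have hmod (i : ℕ) : factorHeight w (i % T) n = factorHeight w i n := by
    refine Finset.sum_congr rfl fun k _ => ?_
    have hp : Function.Periodic w T := hT.2
    rw [← hp.map_mod_nat (i % T + k), ← hp.map_mod_nat (i + k), Nat.mod_add_mod]
  have hswap (r : ℕ) :
      factorHeight w 0 r + factorHeight w r n = factorHeight w 0 n + factorHeight w n r := by
    have h₁ := factorHeight_add (w := w) 0 r n
    have h₂ := factorHeight_add (w := w) 0 n r
    rw [add_comm n r] at h₂
    simp only [zero_add] at h₁ h₂
    omega
  rw [← hmod i, ← hmod j]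
  have := hswap (i % T)
  have := hswap (j % T)
  have := factorHeight_le hw 0 (i % T)
  have := factorHeight_le hw n (j % T)
  have := Nat.mod_lt i hT.1
  have := Nat.mod_lt j hT.1
  omega

end Slope

section Sturmian

variable {w : ℕ → ℕ}

lemma factorAt_eq_iff {n i j : ℕ} :
    factorAt w n i = factorAt w n j ↔ ∀ k < n, w (i + k) = w (j + k) :=
  ⟨fun h k hk => congrFun h ⟨k, hk⟩, fun h => funext fun k => h k k.2⟩

lemma complexity_eq_ncard_range (w : ℕ → ℕ) (n : ℕ) :
    Complexity w n = (Set.range (factorAt w n)).ncard :=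
  congrArg Set.ncard (Set.ext fun _ => exists_congr fun _ => eq_comm)

lemma IsSturmian.ncard_range (h : IsSturmian w) (n : ℕ) :
    (Set.range (factorAt w n)).ncard = n + 1 := by
  rcases Nat.eq_zero_or_pos n with rfl | hn
  · have : Set.range (factorAt w 0) = {factorAt w 0 0} := by
      ext f
      simp [Subsingleton.elim f (factorAt w 0 0)]
    rw [this, Set.ncard_singleton]
  · rw [← complexity_eq_ncard_range, h n hn]

lemma IsSturmian.finite_range (h : IsSturmian w) (n : ℕ) : (Set.range (factorAt w n)).Finite :=
  Set.finite_of_ncard_pos (by rw [h.ncard_range]; omega)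

lemma IsSturmian.exists_rightSpecial (h : IsSturmian w) (n : ℕ) :
    ∃ a b, factorAt w n a = factorAt w n b ∧ w (a + n) ≠ w (b + n) := by
  by_contra! hne
  have hle : (Set.range (factorAt w (n + 1))).ncard ≤ (Set.range (factorAt w n)).ncard := by
    refine Set.ncard_le_ncard_of_injOn Fin.init ?_ ?_ (h.finite_range n)
    · rintro _ ⟨i, rfl⟩
      exact ⟨i, rfl⟩
    · rintro _ ⟨i, rfl⟩ _ ⟨j, rfl⟩ hij
      have hij' : factorAt w n i = factorAt w n j := hij
      refine factorAt_eq_iff.2 fun k hk => ?_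
      rcases Nat.lt_succ_iff_lt_or_eq.1 hk with hk | rfl
      · exact factorAt_eq_iff.1 hij' k hk
      · exact hne i j hij'
  rw [h.ncard_range, h.ncard_range] at hle
  omega

lemma IsSturmian.rightSpecial_unique (h : IsSturmian w) {n a b c d : ℕ}
    (hab : factorAt w n a = factorAt w n b) (hab' : w (a + n) ≠ w (b + n))
    (hcd : factorAt w n c = factorAt w n d) (hcd' : w (c + n) ≠ w (d + n)) :
    factorAt w n a = factorAt w n c := by
  by_contra hac
  have hlast {i j : ℕ} (hij : w (i + n) ≠ w (j + n)) :
      factorAt w (n + 1) i ≠ factorAt w (n + 1) j :=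
    fun he => hij (factorAt_eq_iff.1 he n n.lt_succ_self)
  have hinit {i j : ℕ} (hij : factorAt w n i ≠ factorAt w n j) :
      factorAt w (n + 1) i ≠ factorAt w (n + 1) j :=
    fun he => hij (congrArg Fin.init he)
  have hpair : ({factorAt w (n + 1) a, factorAt w (n + 1) c} : Set (Fin (n + 1) → ℕ)) ⊆
      Set.range (factorAt w (n + 1)) := by
    rintro _ (rfl | rfl) <;> exact ⟨_, rfl⟩
  have hcover : Set.range (factorAt w n) ⊆ Fin.init '' (Set.range (factorAt w (n + 1)) \
      {factorAt w (n + 1) a, factorAt w (n + 1) c}) := by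
    rintro _ ⟨i, rfl⟩
    by_cases hia : factorAt w n i = factorAt w n a
    · refine ⟨factorAt w (n + 1) b, ⟨⟨b, rfl⟩, ?_⟩, (hia.trans hab).symm⟩
      rintro (he | he)
      · exact hlast hab' he.symm
      · exact hinit (hab ▸ hac) he
    · by_cases hic : factorAt w n i = factorAt w n c
      · refine ⟨factorAt w (n + 1) d, ⟨⟨d, rfl⟩, ?_⟩, (hic.trans hcd).symm⟩
        rintro (he | he)
        · exact hinit (hcd ▸ hac) he.symm
        · exact hlast hcd' he.symm
      · refine ⟨factorAt w (n + 1) i, ⟨⟨i, rfl⟩, ?_⟩, rfl⟩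
        rintro (he | he)
        · exact hinit hia he
        · exact hinit hic he
  have hfin := (h.finite_range (n + 1)).sdiff (t := {factorAt w (n + 1) a, factorAt w (n + 1) c})
  have h₁ := Set.ncard_le_ncard hcover (hfin.image _)
  have h₂ := Set.ncard_image_le (f := Fin.init) hfin
  rw [Set.ncard_sdiff hpair, Set.ncard_pair (hinit hac), h.ncard_range] at h₂
  rw [h.ncard_range] at h₁
  omega

/-- A Sturmian word is not eventually periodic. -/
lemma IsSturmian.not_eventually_periodic (h : IsSturmian w) {q r : ℕ} (hqr : q < r)
    (hp : ∀ t, w (q + t) = w (r + t)) : False := by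
  have hsub : Set.range (factorAt w r) ⊆ factorAt w r '' Set.Iio r := by
    rintro _ ⟨i, rfl⟩
    induction i using Nat.strong_induction_on with
    | _ i ih =>
      by_cases hi : i < r
      · exact ⟨i, hi, rfl⟩
      · obtain ⟨s, hs, he⟩ := ih (i - (r - q)) (by omega)
        refine ⟨s, hs, he.trans (factorAt_eq_iff.2 fun k _ => ?_)⟩
        have := hp (i - r + k)
        rwa [show q + (i - r + k) = i - (r - q) + k by omega,
          show r + (i - r + k) = i + k by omega] at this
  have h₁ := Set.ncard_le_ncard hsub ((Set.finite_Iio r).image _)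
  have h₂ := Set.ncard_image_le (f := factorAt w r) (Set.finite_Iio r)
  rw [h.ncard_range] at h₁
  rw [Set.ncard_Iio_nat] at h₂
  omega

/-- In a Sturmian word, the right special factor of length `m` occurs at one of any `m + 1`
consecutive positions. -/
lemma IsSturmian.exists_factorAt_eq (h : IsSturmian w) {m a b : ℕ}
    (hab : factorAt w m a = factorAt w m b) (hab' : w (a + m) ≠ w (b + m)) (p : ℕ) :
    ∃ d ≤ m, factorAt w m (p + d) = factorAt w m a := by
  by_contra! hne
  have hmaps : Set.MapsTo (fun d => factorAt w m (p + d)) (Set.Iic m)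
      (Set.range (factorAt w m) \ {factorAt w m a}) :=
    fun d hd => Set.mem_sdiff_singleton.2 ⟨Set.mem_range_self _, hne d hd⟩
  have hcard : (Set.range (factorAt w m) \ {factorAt w m a}).ncard < (Set.Iic m).ncard := by
    rw [Set.ncard_sdiff_singleton_of_mem (Set.mem_range_self a), h.ncard_range, Set.ncard_Iic_nat]
    omega
  obtain ⟨d, hd, e, he, hde, heq⟩ := Set.exists_ne_map_eq_of_ncard_lt_of_maps_to hcard hmaps
    (h.finite_range m).sdiff
  wlog hlt : d < e generalizing d e
  · exact this e he d hd hde.symm heq.symm (by omega)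
  have hper : ∀ t, w (p + d + t) = w (p + e + t) := by
    intro t
    induction t using Nat.strong_induction_on with
    | _ t ih =>
      by_cases ht : t < m
      · exact factorAt_eq_iff.1 heq t ht
      · have hwin (s : ℕ) (hs : s + m ≤ t) :
            ∃ f ≤ m, factorAt w m (p + d + s) = factorAt w m (p + f) := by
          induction s using Nat.strong_induction_on with
          | _ s ihs =>
            by_cases hsm : d + s ≤ m
            · exact ⟨d + s, hsm, by rw [add_assoc]⟩
            · have hem : e ≤ m := he
              obtain ⟨f, hf, hfe⟩ := ihs (s - (e - d)) (by omega) (by omega)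
              refine ⟨f, hf, Eq.trans (factorAt_eq_iff.2 fun k hk => ?_) hfe⟩
              have := ih (s - (e - d) + k) (by omega)
              rw [show p + e + (s - (e - d) + k) = p + d + s + k by omega, ← add_assoc] at this
              exact this.symm
        obtain ⟨f, hf, hfe⟩ := hwin (t - m) (by omega)
        have heq' : factorAt w m (p + d + (t - m)) = factorAt w m (p + e + (t - m)) := by
          refine factorAt_eq_iff.2 fun k hk => ?_
          rw [add_assoc, add_assoc (p + e)]
          exact ih _ (by omega)
        by_contra hw
        refine hne f hf (hfe.symm.trans ?_)
        refine h.rightSpecial_unique heq' ?_ hab hab'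
        rwa [add_assoc, add_assoc (p + e), Nat.sub_add_cancel (by omega)]
  exact h.not_eventually_periodic (by omega) hper

/-- A shortest pair of unbalanced factors has the form `0u0`, `1u1` with `u` a palindrome. -/
lemma exists_unbalanced_palindrome (hw : IsBinaryWord w)
    (hub : ∃ n i j, factorHeight w i n + 1 < factorHeight w j n) :
    ∃ m i j, 1 ≤ m ∧ w i = 0 ∧ w (i + m) = 0 ∧ w j = 1 ∧ w (j + m) = 1 ∧
      ∀ k, 1 ≤ k → k < m → w (i + k) = w (j + k) ∧ w (i + k) = w (i + (m - k)) := by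
  classical
  obtain ⟨i, j, hij⟩ := Nat.find_spec hub
  have hmin : ∀ k < Nat.find hub, ∀ a b, factorHeight w b k ≤ factorHeight w a k + 1 :=
    fun k hk a b => by
      by_contra hlt
      exact Nat.find_min hub hk ⟨a, b, not_le.1 hlt⟩
  generalize Nat.find hub = n at hij hmin
  have hn : 2 ≤ n := by
    have := factorHeight_le hw j n
    omega
  obtain ⟨m, rfl⟩ : ∃ m, n = m + 1 := ⟨n - 1, by omega⟩
  have hsplit (a k : ℕ) (hk : k ≤ m + 1) :
      factorHeight w a (m + 1) = factorHeight w a k + factorHeight w (a + k) (m + 1 - k) := by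
    rw [← factorHeight_add, Nat.add_sub_cancel' hk]
  have hprefix (k : ℕ) (hk : 1 ≤ k) (hkm : k ≤ m) :
      factorHeight w j k = factorHeight w i k + 1 := by
    have := hsplit i k (by omega)
    have := hsplit j k (by omega)
    have := hmin (m + 1 - k) (by omega) (i + k) (j + k)
    have := hmin k (by omega) i j
    omega
  have hi₁ := factorHeight_succ (w := w) i m
  have hj₁ := factorHeight_succ (w := w) j m
  have hm := hprefix m (by omega) le_rfl
  have h1 := hprefix 1 le_rfl (by omega)
  simp only [factorHeight, Finset.sum_range_one, add_zero] at h1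
  have hbi := hw (i + m)
  have hbj := hw (j + m)
  have hbj0 := hw j
  have htop : factorHeight w j (m + 1) = factorHeight w i (m + 1) + 2 := by omega
  have hpal (k : ℕ) (hk : 1 ≤ k) (hkm : k ≤ m) :
      factorHeight w i k + factorHeight w i (m + 1 - k) = factorHeight w i (m + 1) := by
    have hi := hsplit i (m + 1 - k) (by omega)
    have hj := hsplit j (m + 1 - k) (by omega)
    rw [Nat.sub_sub_self (by omega)] at hi hj
    have := hmin k (by omega) (i + (m + 1 - k)) j
    have := hmin k (by omega) i (j + (m + 1 - k))
    have := hprefix k hk hkm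
    have := hprefix (m + 1 - k) (by omega) (by omega)
    omega
  refine ⟨m, i, j, by omega, by omega, by omega, by omega, by omega, fun k hk hkm => ⟨?_, ?_⟩⟩
  · have := hprefix k hk hkm.le
    have := hprefix (k + 1) (by omega) hkm
    have := factorHeight_succ (w := w) i k
    have := factorHeight_succ (w := w) j k
    omega
  · have := hpal k hk hkm.le
    have hs := hpal (k + 1) (by omega) hkm
    rw [Nat.add_sub_add_right] at hs
    have := factorHeight_succ (w := w) i k
    have hl := factorHeight_succ (w := w) i (m - k)
    rw [← Nat.sub_add_comm hkm.le] at hl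
    omega

/-- Sturmian words are balanced. -/
lemma IsSturmian.balanced (hw : IsBinaryWord w) (h : IsSturmian w) (i j n : ℕ) :
    factorHeight w j n ≤ factorHeight w i n + 1 := by
  by_contra hlt
  obtain ⟨m, i, j, hm, hi, him, hj, hjm, hpal⟩ :=
    exists_unbalanced_palindrome hw ⟨n, i, j, not_le.1 hlt⟩
  obtain ⟨a, b, hab, hab'⟩ := h.exists_rightSpecial m
  have hshift (q : ℕ) (k : ℕ) : q + 1 + k = q + (k + 1) := by omega
  have hend (q : ℕ) : q + 1 + (m - 1) = q + m := by omega
  have hai : factorAt w (m - 1) (a + 1) = factorAt w (m - 1) (i + 1) := by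
    refine h.rightSpecial_unique (b := b + 1) (d := j + 1) ?_ ?_ ?_ ?_
    · refine factorAt_eq_iff.2 fun k hk => ?_
      rw [hshift, hshift]
      exact factorAt_eq_iff.1 hab _ (by omega)
    · rwa [hend, hend]
    · refine factorAt_eq_iff.2 fun k hk => ?_
      rw [hshift, hshift]
      exact (hpal _ (by omega) (by omega)).1
    · rw [hend, hend]
      omega
  have hai' (k : ℕ) (hk : 1 ≤ k) (hkm : k < m) : w (a + k) = w (i + k) := by
    have := factorAt_eq_iff.1 hai (k - 1) (by omega)
    rwa [hshift, hshift, Nat.sub_add_cancel hk] at this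
  obtain ⟨p, hpa, hpm, hp⟩ : ∃ p, w p ≠ w a ∧ w (p + m) = w p ∧
      ∀ k, 1 ≤ k → k < m → w (p + k) = w (a + k) ∧ w (p + k) = w (p + (m - k)) := by
    by_cases ha : w a = 0
    · refine ⟨j, by omega, by omega, fun k hk hkm => ?_⟩
      have := hpal k hk hkm
      have := hpal (m - k) (by omega) (by omega)
      have := hai' k hk hkm
      omega
    · refine ⟨i, by omega, by omega, fun k hk hkm => ?_⟩
      have := hpal k hk hkm
      have := hai' k hk hkm
      omega
  obtain ⟨d, hdm, hd⟩ := h.exists_factorAt_eq hab hab' p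
  have hd' := factorAt_eq_iff.1 hd
  have hd0 := hd' 0 (by omega)
  simp only [add_zero] at hd0
  rcases Nat.eq_zero_or_pos d with rfl | hdpos
  · exact hpa hd0
  rcases hdm.eq_or_lt with rfl | hdlt
  · exact hpa (hpm.symm.trans hd0)
  have hlast := hd' (m - d) (by omega)
  rw [add_assoc, Nat.add_sub_cancel' hdm] at hlast
  have := hp d hdpos hdlt
  have := hp (m - d) (by omega) (by omega)
  omega

end Sturmian

/-- If `w` is Sturmian or periodic, then the slope `π(w)` exists and there is a
constant `C` such that every nonempty finite factor `u` of `w` satisfies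
`|π(u) - π(w)| ≤ C/|u|`. -/
theorem slope_of_factor_close (w : ℕ → ℕ) (hw : IsBinaryWord w)
    (h : IsSturmian w ∨ ∃ T, IsPeriodicWord w T) :
    ∃ α : ℝ, HasSlope w α ∧
      ∃ C : ℝ, ∀ i n : ℕ, 1 ≤ n →
        |(∑ j ∈ Finset.range n, (w (i + j) : ℝ)) / n - α| ≤ C / n := by
  rcases h with h | ⟨T, hT⟩
  · exact exists_slope_of_balanced (h.balanced hw)
  · exact exists_slope_of_balanced (hT.balanced hw)
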